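/- Each finite-dimensional algebra H^{1/n!} ⊂ B(L²(𝕋^N → ℂ^M)) is *-isomorphic to the full matrix algebra of size M·(n!)^N, and the inclusion H^{1/n!} ↪ H^{1/(n+1)!} is a unital *-embedding; consequently the closure of ⋃_n H^{1/n!} is a UHF C*-algebra whose associated supernatural number is sup_n M·(n!)^N, which contains every prime with infinite multiplicity. -/

import Mathlib

open MeasureTheory

noncomputable section

abbrev Torus (N : ℕ) := Fin N → AddCircle (1 : ℝ)

abbrev L2 (N M : ℕ) := Lp (EuclideanSpace ℂ (Fin M)) 2 (volume : Measure (Torus N))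

/-- The canonical representative in `[0,1)` of a point of `𝕋 = ℝ/ℤ`. -/
def lift1 (x : AddCircle (1 : ℝ)) : ℝ := (AddCircle.equivIco 1 0 x : ℝ)

/-- The index of the cube of side `1/p` containing `x ∈ 𝕋^N`. -/
def cubeIdxZ (N p : ℕ) (x : Torus N) : Fin N → ℤ := fun i => ⌊lift1 (x i) * p⌋

/-- The shift vector `j/p ∈ 𝕋^N` for `j ∈ {0,…,p−1}^N`. -/
def hvecF (N p : ℕ) (j : Fin N → Fin p) : Torus N :=
  fun i => ((((j i : ℕ) : ℝ) / p : ℝ) : AddCircle (1 : ℝ))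

/-- `(A u)(x) = Σ_{j} A_j(x) u(x + j/p)` with the step coefficient `A_j` having constant
value `C j r` on the cube of side `1/p` indexed by `r`. -/
def opOfF (N M p : ℕ)
    (C : (Fin N → Fin p) → (Fin N → ℤ) → Matrix (Fin M) (Fin M) ℂ)
    (u : Torus N → EuclideanSpace ℂ (Fin M)) : Torus N → EuclideanSpace ℂ (Fin M) :=
  fun x => ∑ j : Fin N → Fin p,
    Matrix.toEuclideanCLM (𝕜 := ℂ) (C j (cubeIdxZ N p x)) (u (x + hvecF N p j))

/-- The finite-dimensional algebra `H^{1/p}` of shift operators with cube-step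
coefficients of step `1/p`. -/
def HsetF (N M p : ℕ) : Set (L2 N M →L[ℂ] L2 N M) :=
  {T | ∃ C, ∀ u : L2 N M,
    (T u : Torus N → EuclideanSpace ℂ (Fin M)) =ᵐ[volume] opOfF N M p C u}


theorem lift1_coe (t : ℝ) : lift1 (t : AddCircle (1 : ℝ)) = Int.fract t := by
  simp [lift1, AddCircle.coe_equivIco_mk_apply]

theorem lift1_nonneg (x : AddCircle (1 : ℝ)) : 0 ≤ lift1 x :=
  (AddCircle.equivIco 1 0 x).2.1

theorem coe_lift1 (x : AddCircle (1 : ℝ)) : (lift1 x : AddCircle (1 : ℝ)) = x :=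
  AddCircle.coe_equivIco

theorem measurable_lift1 : Measurable lift1 :=
  measurable_subtype_coe.comp (AddCircle.measurableEquivIco (1 : ℝ) 0).measurable

/-- The floor of `p` times the representative of `t mod 1` is `⌊t p⌋` reduced modulo `p`. -/
theorem floor_lift1_coe_mul (p : ℕ) [NeZero p] (t : ℝ) :
    ⌊lift1 (t : AddCircle (1 : ℝ)) * p⌋ = ⌊t * p⌋ % (p : ℤ) := by
  have hp : (0 : ℝ) < p := by exact_mod_cast Nat.pos_of_neZero p
  have h1 : Int.fract t * p = t * p - ((⌊t⌋ * p : ℤ) : ℝ) := by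
    rw [Int.fract]; push_cast; ring
  have h0 : 0 ≤ ⌊Int.fract t * p⌋ := Int.floor_nonneg.2 (by have := Int.fract_nonneg t; positivity)
  have h2 : ⌊Int.fract t * p⌋ < p := by
    rw [Int.floor_lt]
    have := Int.fract_lt_one t
    push_cast
    nlinarith
  rw [lift1_coe, ← Int.emod_eq_of_lt h0 h2, h1, Int.floor_sub_intCast]
  simp [Int.sub_emod]

theorem floor_lift1_mul_nonneg (p : ℕ) (x : AddCircle (1 : ℝ)) : 0 ≤ ⌊lift1 x * p⌋ :=
  Int.floor_nonneg.2 (mul_nonneg (lift1_nonneg x) p.cast_nonneg)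

/-- The index of the cube of side `1/p` containing `x`, as an element of `(ℤ/p)^N`. -/
def cubeIdx (N p : ℕ) [NeZero p] (x : Torus N) : Fin N → Fin p :=
  fun i => Fin.ofNat p ⌊lift1 (x i) * p⌋.toNat

theorem val_cubeIdx (N p : ℕ) [NeZero p] (x : Torus N) (i : Fin N) :
    ((cubeIdx N p x i : ℕ) : ℤ) = cubeIdxZ N p x i := by
  have h : ⌊lift1 (x i) * p⌋ = ⌊lift1 (x i) * p⌋ % (p : ℤ) := by
    conv_lhs => rw [← coe_lift1 (x i), floor_lift1_coe_mul]
  simp only [cubeIdx, cubeIdxZ, Fin.val_ofNat, Int.natCast_emod,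
    Int.toNat_of_nonneg (floor_lift1_mul_nonneg p (x i))]
  exact h.symm

theorem measurable_cubeIdx (N p : ℕ) [NeZero p] : Measurable (cubeIdx N p) := by
  refine measurable_pi_lambda _ fun i => ?_
  exact (measurable_of_countable fun n : ℤ => Fin.ofNat p n.toNat).comp
    (Int.measurable_floor.comp ((measurable_lift1.comp (measurable_pi_apply i)).mul_const _))

theorem cubeIdx_add_hvecF (N p : ℕ) [NeZero p] (x : Torus N) (j : Fin N → Fin p) :
    cubeIdx N p (x + hvecF N p j) = cubeIdx N p x + j := by
  have hp : (p : ℝ) ≠ 0 := by exact_mod_cast NeZero.ne p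
  funext i
  apply Fin.ext
  zify
  rw [val_cubeIdx]
  have h : (x + hvecF N p j) i = ((lift1 (x i) + (j i : ℕ) / p : ℝ) : AddCircle (1 : ℝ)) := by
    simp [hvecF, coe_lift1]
  have h2 : (lift1 (x i) + (j i : ℕ) / p : ℝ) * p = lift1 (x i) * p + (j i : ℕ) := by
    field_simp
  simp only [cubeIdxZ]
  rw [h, floor_lift1_coe_mul, h2, Int.floor_add_natCast]
  have h3 := val_cubeIdx N p x i
  simp only [cubeIdxZ] at h3
  rw [← h3, Pi.add_apply, Fin.val_add]
  push_cast
  rfl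

theorem hvecF_zero (N p : ℕ) [NeZero p] : hvecF N p 0 = 0 := by
  funext i
  simp [hvecF]

theorem hvecF_add (N p : ℕ) [NeZero p] (j k : Fin N → Fin p) :
    hvecF N p (j + k) = hvecF N p j + hvecF N p k := by
  have hp : (p : ℝ) ≠ 0 := by exact_mod_cast NeZero.ne p
  funext i
  simp only [hvecF, Pi.add_apply, ← AddCircle.coe_add]
  rw [← sub_eq_zero, ← AddCircle.coe_sub, AddCircle.coe_eq_zero_iff]
  refine ⟨-(((j i : ℕ) + (k i : ℕ)) / p : ℕ), ?_⟩
  have h := Nat.mod_add_div ((j i : ℕ) + (k i : ℕ)) p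
  rw [Fin.val_add]
  generalize ((j i : ℕ) + (k i : ℕ)) / p = d at *
  generalize ((j i : ℕ) + (k i : ℕ)) % p = e at *
  have h' : (e : ℝ) + p * d = (j i : ℕ) + (k i : ℕ) := by exact_mod_cast h
  simp only [zsmul_eq_mul]
  push_cast
  field_simp
  linarith

/-- The translation operator `u ↦ u(· + h)` on `L²`. -/
def shiftOp (N M : ℕ) (h : Torus N) : L2 N M →L[ℂ] L2 N M :=
  (Lp.compMeasurePreservingₗᵢ ℂ (· + h) (measurePreserving_add_right volume h)).toContinuousLinearMap

theorem coeFn_shiftOp {N M : ℕ} (h : Torus N) (u : L2 N M) :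
    shiftOp N M h u =ᵐ[volume] fun x => u (x + h) :=
  Lp.coeFn_compMeasurePreserving u (measurePreserving_add_right volume h)

theorem ae_comp_add {N : ℕ} (h : Torus N) {P : Torus N → Prop} (hP : ∀ᵐ x, P x) :
    ∀ᵐ x, P (x + h) :=
  (measurePreserving_add_right volume h).quasiMeasurePreserving.ae hP

theorem shiftOp_zero (N M : ℕ) : shiftOp N M 0 = 1 := by
  ext1 u
  refine Lp.ext ?_
  filter_upwards [coeFn_shiftOp 0 u] with x hx
  simp [hx]

theorem shiftOp_add {N M : ℕ} (h k : Torus N) :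
    shiftOp N M (h + k) = shiftOp N M h * shiftOp N M k := by
  ext1 u
  refine Lp.ext ?_
  filter_upwards [coeFn_shiftOp (h + k) u, coeFn_shiftOp h (shiftOp N M k u),
    ae_comp_add h (coeFn_shiftOp k u)] with x h1 h2 h3
  rw [h1, mul_apply_eq_comp, h2, h3, add_assoc]

theorem star_shiftOp {N M : ℕ} (h : Torus N) :
    star (shiftOp N M h) = shiftOp N M (-h) := by
  rw [ContinuousLinearMap.star_eq_adjoint, eq_comm, ContinuousLinearMap.eq_adjoint_iff]
  intro u v
  have hu : shiftOp N M h (shiftOp N M (-h) u) = u := by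
    rw [← mul_apply_eq_comp, ← shiftOp_add, add_neg_cancel, shiftOp_zero,
      one_apply_eq_self]
  conv_rhs => rw [← hu]
  exact (LinearIsometry.inner_map_map (𝕜 := ℂ) (E := L2 N M) (E' := L2 N M)
    (Lp.compMeasurePreservingₗᵢ ℂ (· + h) (measurePreserving_add_right volume h)) _ _).symm

section StepOp

variable {N M p : ℕ}

theorem exists_norm_step_le (F : (Fin N → Fin p) → Matrix (Fin M) (Fin M) ℂ) :
    ∃ c : ℝ, ∀ r, ‖Matrix.toEuclideanCLM (𝕜 := ℂ) (F r)‖ ≤ c :=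
  (Set.finite_range fun r => ‖Matrix.toEuclideanCLM (𝕜 := ℂ) (F r)‖).bddAbove.imp
    fun _ hc r => hc ⟨r, rfl⟩

variable [NeZero p]

theorem memLp_step_apply (F : (Fin N → Fin p) → Matrix (Fin M) (Fin M) ℂ) (u : L2 N M) :
    MemLp (fun x => Matrix.toEuclideanCLM (𝕜 := ℂ) (F (cubeIdx N p x)) (u x)) 2 volume := by
  obtain ⟨c, hc⟩ := exists_norm_step_le F
  refine (Lp.memLp u).of_le_mul (c := c) ?_
    (.of_forall fun x => ContinuousLinearMap.le_of_opNorm_le _ (hc _) _)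
  have h : StronglyMeasurable fun r => Matrix.toEuclideanCLM (𝕜 := ℂ) (F r) :=
    StronglyMeasurable.of_discrete
  exact isBoundedBilinearMap_apply.continuous.comp_aestronglyMeasurable
    ((h.comp_measurable (measurable_cubeIdx N p)).aestronglyMeasurable.prodMk
      (Lp.aestronglyMeasurable u))

/-- Multiplication on `L²` by the matrix-valued step function with values `F`. -/
def stepOp (F : (Fin N → Fin p) → Matrix (Fin M) (Fin M) ℂ) : L2 N M →L[ℂ] L2 N M :=
  LinearMap.mkContinuousOfExistsBound
    { toFun := fun u => (memLp_step_apply F u).toLp _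
      map_add' := fun u v => by
        refine Lp.ext ?_
        filter_upwards [(memLp_step_apply F (u + v)).coeFn_toLp, (memLp_step_apply F u).coeFn_toLp,
          (memLp_step_apply F v).coeFn_toLp, Lp.coeFn_add u v,
          Lp.coeFn_add ((memLp_step_apply F u).toLp _) ((memLp_step_apply F v).toLp _)]
          with x h1 h2 h3 h4 h5
        rw [h1, h5, Pi.add_apply, h2, h3, h4, Pi.add_apply, map_add]
      map_smul' := fun c u => by
        refine Lp.ext ?_
        filter_upwards [(memLp_step_apply F (c • u)).coeFn_toLp, (memLp_step_apply F u).coeFn_toLp,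
          Lp.coeFn_smul c u, Lp.coeFn_smul c ((memLp_step_apply F u).toLp _)]
          with x h1 h2 h3 h4
        rw [h1, RingHom.id_apply, h4, Pi.smul_apply, h2, h3, Pi.smul_apply, map_smul] }
    (by
      obtain ⟨c, hc⟩ := exists_norm_step_le F
      refine ⟨c, fun u => Lp.norm_le_mul_norm_of_ae_le_mul ?_⟩
      filter_upwards [(memLp_step_apply F u).coeFn_toLp] with x hx
      exact hx ▸ ContinuousLinearMap.le_of_opNorm_le _ (hc _) _)

theorem coeFn_stepOp (F : (Fin N → Fin p) → Matrix (Fin M) (Fin M) ℂ) (u : L2 N M) :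
    stepOp F u =ᵐ[volume] fun x => Matrix.toEuclideanCLM (𝕜 := ℂ) (F (cubeIdx N p x)) (u x) :=
  (memLp_step_apply F u).coeFn_toLp

theorem stepOp_one : stepOp (1 : (Fin N → Fin p) → Matrix (Fin M) (Fin M) ℂ) = 1 := by
  ext1 u
  refine Lp.ext ?_
  filter_upwards [coeFn_stepOp (1 : (Fin N → Fin p) → Matrix (Fin M) (Fin M) ℂ) u] with x hx
  simp [hx]

theorem stepOp_mul (F G : (Fin N → Fin p) → Matrix (Fin M) (Fin M) ℂ) :
    stepOp (F * G) = stepOp F * stepOp G := by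
  ext1 u
  refine Lp.ext ?_
  filter_upwards [coeFn_stepOp (F * G) u, coeFn_stepOp F (stepOp G u), coeFn_stepOp G u]
    with x h1 h2 h3
  rw [h1, mul_apply_eq_comp, h2, h3, Pi.mul_apply, map_mul,
    mul_apply_eq_comp]

theorem stepOp_add (F G : (Fin N → Fin p) → Matrix (Fin M) (Fin M) ℂ) :
    stepOp (F + G) = stepOp F + stepOp G := by
  ext1 u
  refine Lp.ext ?_
  filter_upwards [coeFn_stepOp (F + G) u, coeFn_stepOp F u, coeFn_stepOp G u,
    Lp.coeFn_add (stepOp F u) (stepOp G u)] with x h1 h2 h3 h4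
  rw [h1, add_apply, h4, Pi.add_apply (f := ⇑(stepOp F u)), h2, h3, Pi.add_apply, map_add,
    add_apply]

theorem stepOp_smul (c : ℂ) (F : (Fin N → Fin p) → Matrix (Fin M) (Fin M) ℂ) :
    stepOp (c • F) = c • stepOp F := by
  ext1 u
  refine Lp.ext ?_
  filter_upwards [coeFn_stepOp (c • F) u, coeFn_stepOp F u,
    Lp.coeFn_smul c (stepOp F u)] with x h1 h2 h3
  rw [h1, smul_apply, h3, Pi.smul_apply c (⇑(stepOp F u)), h2, Pi.smul_apply, map_smul,
    smul_apply]

theorem star_stepOp (F : (Fin N → Fin p) → Matrix (Fin M) (Fin M) ℂ) :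
    star (stepOp F) = stepOp (star F) := by
  rw [ContinuousLinearMap.star_eq_adjoint, eq_comm, ContinuousLinearMap.eq_adjoint_iff]
  intro u v
  rw [L2.inner_def, L2.inner_def]
  refine integral_congr_ae ?_
  filter_upwards [coeFn_stepOp (star F) u, coeFn_stepOp F v] with x h1 h2
  rw [h1, h2, Pi.star_apply, map_star, ContinuousLinearMap.star_eq_adjoint,
    ContinuousLinearMap.adjoint_inner_left]

theorem shiftOp_mul_stepOp (j : Fin N → Fin p)
    (F : (Fin N → Fin p) → Matrix (Fin M) (Fin M) ℂ) :
    shiftOp N M (hvecF N p j) * stepOp F =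
      stepOp (fun r => F (r + j)) * shiftOp N M (hvecF N p j) := by
  ext1 u
  refine Lp.ext ?_
  filter_upwards [coeFn_shiftOp (hvecF N p j) (stepOp F u),
    ae_comp_add (hvecF N p j) (coeFn_stepOp F u),
    coeFn_stepOp (fun r => F (r + j)) (shiftOp N M (hvecF N p j) u),
    coeFn_shiftOp (hvecF N p j) u] with x h1 h2 h3 h4
  rw [mul_apply_eq_comp, mul_apply_eq_comp, h1, h2, h3, h4,
    cubeIdx_add_hvecF]

/-- `stepOp` as a linear map. -/
def stepLin (N M p : ℕ) [NeZero p] :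
    ((Fin N → Fin p) → Matrix (Fin M) (Fin M) ℂ) →ₗ[ℂ] (L2 N M →L[ℂ] L2 N M) where
  toFun := stepOp
  map_add' := stepOp_add
  map_smul' := stepOp_smul

theorem hvecF_neg (j : Fin N → Fin p) : hvecF N p (-j) = -hvecF N p j :=
  eq_neg_of_add_eq_zero_left (by rw [← hvecF_add, neg_add_cancel, hvecF_zero])

/-- The `j`-th generalized diagonal of a block matrix indexed by `(ℤ/p)^N`, as a step
function. -/
def shiftedDiag (B : Matrix ((Fin N → Fin p) × Fin M) ((Fin N → Fin p) × Fin M) ℂ)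
    (j r : Fin N → Fin p) : Matrix (Fin M) (Fin M) ℂ :=
  B.submatrix (Prod.mk r) (Prod.mk (r + j))

/-- The operator `∑ⱼ Bⱼ Sⱼ` on `L²` attached to a block matrix `B`, where `Bⱼ` is the step function
given by the `j`-th generalized diagonal and `Sⱼ` is the translation by `j/p`. -/
def blockOp (B : Matrix ((Fin N → Fin p) × Fin M) ((Fin N → Fin p) × Fin M) ℂ) :
    L2 N M →L[ℂ] L2 N M :=
  ∑ j, stepOp (shiftedDiag B j) * shiftOp N M (hvecF N p j)

theorem blockOp_add (A B : Matrix ((Fin N → Fin p) × Fin M) ((Fin N → Fin p) × Fin M) ℂ) :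
    blockOp (A + B) = blockOp A + blockOp B := by
  simp only [blockOp, ← Finset.sum_add_distrib, ← add_mul, ← stepOp_add]
  rfl

theorem blockOp_smul (c : ℂ) (B : Matrix ((Fin N → Fin p) × Fin M) ((Fin N → Fin p) × Fin M) ℂ) :
    blockOp (c • B) = c • blockOp B := by
  simp only [blockOp, Finset.smul_sum, ← smul_mul_assoc, ← stepOp_smul]
  rfl

theorem blockOp_one :
    blockOp (1 : Matrix ((Fin N → Fin p) × Fin M) ((Fin N → Fin p) × Fin M) ℂ) = 1 := by
  rw [blockOp, Finset.sum_eq_single 0]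
  · rw [hvecF_zero, shiftOp_zero, mul_one, ← stepOp_one (p := p)]
    congr 1
    ext r a b
    simp [shiftedDiag, Matrix.one_apply]
  · intro j _ hj
    have : shiftedDiag (M := M) 1 j = 0 := by
      ext r a b
      simp [shiftedDiag, hj]
    rw [this]
    exact (congrArg (· * _) (stepLin N M p).map_zero).trans (zero_mul _)
  · simp

theorem blockOp_mul (A B : Matrix ((Fin N → Fin p) × Fin M) ((Fin N → Fin p) × Fin M) ℂ) :
    blockOp (A * B) = blockOp A * blockOp B := by
  have key (l : Fin N → Fin p) : shiftedDiag (A * B) l =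
      ∑ j, shiftedDiag A j * fun r => shiftedDiag B (l - j) (r + j) := by
    ext r a b
    simp only [shiftedDiag, Matrix.submatrix_apply, Matrix.mul_apply, Fintype.sum_prod_type,
      Finset.sum_apply, Pi.mul_apply, Matrix.sum_apply]
    rw [← Equiv.sum_comp (Equiv.addLeft r)]
    simp [add_assoc]
  have hl (j l : Fin N → Fin p) : shiftOp N M (hvecF N p l) =
      shiftOp N M (hvecF N p j) * shiftOp N M (hvecF N p (l - j)) := by
    rw [← shiftOp_add, ← hvecF_add, add_sub_cancel]
  have hs (l : Fin N → Fin p) : stepOp (shiftedDiag (A * B) l) =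
      ∑ j, stepOp (shiftedDiag A j) * stepOp (fun r => shiftedDiag B (l - j) (r + j)) := by
    simp only [key, ← stepOp_mul]
    exact map_sum (stepLin N M p) _ _
  simp only [blockOp, hs, Finset.sum_mul, Finset.mul_sum]
  rw [Finset.sum_comm]
  conv_rhs => rw [Finset.sum_comm]
  refine Finset.sum_congr rfl fun j _ => ?_
  rw [← Equiv.sum_comp (Equiv.subRight j) fun k => stepOp (shiftedDiag A j) *
    shiftOp N M (hvecF N p j) * (stepOp (shiftedDiag B k) * shiftOp N M (hvecF N p k))]
  refine Finset.sum_congr rfl fun l _ => ?_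
  rw [Equiv.subRight_apply, hl j l, mul_assoc, mul_assoc, ← mul_assoc (shiftOp _ _ _) (stepOp _),
    shiftOp_mul_stepOp, mul_assoc]

theorem star_blockOp (B : Matrix ((Fin N → Fin p) × Fin M) ((Fin N → Fin p) × Fin M) ℂ) :
    blockOp (star B) = star (blockOp B) := by
  rw [blockOp, blockOp, star_sum, ← Equiv.sum_comp (Equiv.neg _)]
  refine Finset.sum_congr rfl fun j _ => ?_
  rw [star_mul, star_shiftOp, star_stepOp, ← hvecF_neg, shiftOp_mul_stepOp, Equiv.neg_apply]
  congr 2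
  ext r a b
  simp [shiftedDiag, Matrix.star_apply]

/-- `blockOp` as a `*`-homomorphism of the full matrix algebra into `B(L²)`. -/
def blockHom (N M p : ℕ) [NeZero p] :
    Matrix ((Fin N → Fin p) × Fin M) ((Fin N → Fin p) × Fin M) ℂ →⋆ₐ[ℂ] (L2 N M →L[ℂ] L2 N M) :=
  { AlgHom.ofLinearMap ⟨⟨blockOp, blockOp_add⟩, blockOp_smul⟩ blockOp_one blockOp_mul with
    map_star' := star_blockOp }

theorem coeFn_blockOp (B : Matrix ((Fin N → Fin p) × Fin M) ((Fin N → Fin p) × Fin M) ℂ)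
    (u : L2 N M) :
    blockOp B u =ᵐ[volume] fun x => ∑ j, Matrix.toEuclideanCLM (𝕜 := ℂ)
      (shiftedDiag B j (cubeIdx N p x)) (u (x + hvecF N p j)) := by
  have h : blockOp B u = ∑ j, stepOp (shiftedDiag B j) (shiftOp N M (hvecF N p j) u) := by
    simp [blockOp]
  have h1 : ∀ᵐ x, ∀ j, stepOp (shiftedDiag B j) (shiftOp N M (hvecF N p j) u) x =
      Matrix.toEuclideanCLM (𝕜 := ℂ) (shiftedDiag B j (cubeIdx N p x)) (u (x + hvecF N p j)) := by
    refine ae_all_iff.2 fun j => ?_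
    filter_upwards [coeFn_stepOp (shiftedDiag B j) (shiftOp N M (hvecF N p j) u),
      coeFn_shiftOp (hvecF N p j) u] with x h2 h3
    rw [h2, h3]
  rw [h]
  filter_upwards [h1, Lp.coeFn_fun_finsetSum Finset.univ
    fun j => stepOp (shiftedDiag B j) (shiftOp N M (hvecF N p j) u)] with x h2 h3
  rw [h3]
  exact Finset.sum_congr rfl fun j _ => h2 j

theorem range_blockHom : Set.range (blockHom N M p) = HsetF N M p := by
  ext T
  constructor
  · rintro ⟨B, rfl⟩
    refine ⟨fun j r => shiftedDiag B j fun i => Fin.ofNat p (r i).toNat, fun u => ?_⟩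
    exact coeFn_blockOp B u
  · rintro ⟨C, hC⟩
    refine ⟨Matrix.of fun s t => C (t.1 - s.1) (fun i => ((s.1 i : ℕ) : ℤ)) s.2 t.2, ?_⟩
    ext1 u
    refine Lp.ext ((coeFn_blockOp _ u).trans (.trans (.of_forall fun x => ?_) (hC u).symm))
    refine Finset.sum_congr rfl fun j _ => ?_
    congr 2
    ext a b
    simp [shiftedDiag, val_cubeIdx]

theorem one_mem_HsetF : (1 : L2 N M →L[ℂ] L2 N M) ∈ HsetF N M p :=
  range_blockHom (N := N) (M := M) (p := p) ▸ ⟨1, map_one _⟩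

end StepOp

theorem HsetF_subset_mul (N M p d : ℕ) [NeZero p] [NeZero d] :
    HsetF N M p ⊆ HsetF N M (p * d) := by
  have hd : (d : ℝ) ≠ 0 := by exact_mod_cast NeZero.ne d
  have hd0 : 0 < d := Nat.pos_of_neZero d
  rintro T ⟨C, hC⟩
  classical
  let e : (Fin N → Fin p) → Fin N → Fin (p * d) :=
    fun j i => ⟨j i * d, Nat.mul_lt_mul_of_pos_right (j i).2 hd0⟩
  have he : Function.Injective e := fun j k h => by
    funext i
    have := congrArg Fin.val (congrFun h i)
    exact Fin.ext (Nat.eq_of_mul_eq_mul_right hd0 this)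
  refine ⟨fun j r => if h : ∃ k, e k = j then C h.choose fun i => r i / d else 0, fun u => ?_⟩
  refine (hC u).trans (.of_forall fun x => ?_)
  refine Fintype.sum_of_injective e he _ _ (fun j hj => ?_) fun j => ?_
  · beta_reduce
    rw [dif_neg (show ¬∃ k, e k = j from hj), map_zero, zero_apply]
  · have h : ∃ k, e k = e j := ⟨j, rfl⟩
    have h1 : h.choose = j := he h.choose_spec
    have h2 : (fun i => cubeIdxZ N (p * d) x i / d) = cubeIdxZ N p x := by
      funext i
      simp only [cubeIdxZ]
      rw [← Int.floor_div_natCast]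
      congr 1
      push_cast
      field_simp
    have h3 : hvecF N (p * d) (e j) = hvecF N p j := by
      funext i
      simp only [hvecF, e]
      congr 1
      push_cast
      field_simp
    beta_reduce
    rw [dif_pos h, h1, h2, h3]

theorem nontrivial_L2 (N M : ℕ) (hM : 0 < M) : Nontrivial (L2 N M) := by
  refine ⟨⟨Lp.const 2 volume (EuclideanSpace.single ⟨0, hM⟩ 1), 0, fun h => ?_⟩⟩
  have h1 := congrArg norm h
  rw [Lp.norm_const' _ _ _ two_ne_zero ENNReal.ofNat_ne_top, norm_zero] at h1
  simp [measureReal_def, volume_pi, Measure.pi_univ] at h1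

/-- Each finite-dimensional algebra `H^{1/n!}` is `*`-isomorphic to the full
matrix algebra of size `M·(n!)^N` (via an injective unital `*`-homomorphism of the matrix
algebra into `B(L²)` with range `H^{1/n!}`), the inclusion `H^{1/n!} ⊆ H^{1/(n+1)!}` is a
unital `*`-embedding, and the associated supernatural number `sup_n M·(n!)^N` contains every
prime with infinite multiplicity: for every prime `q` and every `k` there is `n` with
`q^k ∣ M·(n!)^N`. -/
theorem stmt18 (N M : ℕ) (hN : 0 < N) (hM : 0 < M) :
    (∀ n : ℕ, 1 ≤ n →
      ∃ Φ : Matrix (Fin (M * (Nat.factorial n) ^ N)) (Fin (M * (Nat.factorial n) ^ N)) ℂ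
          →⋆ₐ[ℂ] (L2 N M →L[ℂ] L2 N M),
        Function.Injective Φ ∧ Φ 1 = 1 ∧
        Set.range Φ = HsetF N M (Nat.factorial n)) ∧
    (∀ n : ℕ, (1 : L2 N M →L[ℂ] L2 N M) ∈ HsetF N M (Nat.factorial n) ∧
      HsetF N M (Nat.factorial n) ⊆ HsetF N M (Nat.factorial (n + 1))) ∧
    (∀ q k : ℕ, q.Prime → ∃ n : ℕ, q ^ k ∣ M * (Nat.factorial n) ^ N) := by
  refine ⟨fun n _ => ?_, fun n => ?_, fun q k hq => ?_⟩
  · have : NeZero n.factorial := ⟨n.factorial_ne_zero⟩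
    have := nontrivial_L2 N M hM
    have : Nonempty (Fin (M * n.factorial ^ N)) :=
      ⟨⟨0, Nat.mul_pos hM (pow_pos n.factorial_pos N)⟩⟩
    let e : Fin (M * n.factorial ^ N) ≃ (Fin N → Fin n.factorial) × Fin M :=
      Fintype.equivOfCardEq (by simp [mul_comm])
    let R : Matrix (Fin (M * n.factorial ^ N)) (Fin (M * n.factorial ^ N)) ℂ →⋆ₐ[ℂ]
        Matrix ((Fin N → Fin n.factorial) × Fin M) ((Fin N → Fin n.factorial) × Fin M) ℂ :=
      { (Matrix.reindexAlgEquiv ℂ ℂ e).toAlgHom with map_star' := fun _ => rfl }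
    have hR : Function.Surjective R := (Matrix.reindexAlgEquiv ℂ ℂ e).surjective
    refine ⟨(blockHom N M n.factorial).comp R, ?_, map_one _, ?_⟩
    · exact RingHom.injective ((blockHom N M n.factorial).comp R).toAlgHom.toRingHom
    · rw [StarAlgHom.coe_comp, hR.range_comp, range_blockHom]
  · have : NeZero n.factorial := ⟨n.factorial_ne_zero⟩
    refine ⟨one_mem_HsetF, ?_⟩
    rw [Nat.factorial_succ, mul_comm]
    exact HsetF_subset_mul N M n.factorial (n + 1)
  · exact ⟨q ^ k, ((Nat.dvd_factorial (pow_pos hq.pos k) le_rfl).trans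
      (dvd_pow_self _ hN.ne')).mul_left M⟩
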